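/- arXiv:2506.22117 — 4 statements merged into one kernel-verified Lean document; each statement's English description precedes it below -/
import Mathlib

section
/- Let n be a positive integer, α : ℝ → ℝ an extended class-K function (continuous, strictly increasing, α(0) = 0), h : ℝⁿ → ℝ continuously differentiable, S ⊆ ℝⁿ a set with {z ∈ ℝⁿ : h z ≥ 0} ⊆ S, t₀ ∈ ℝ, and x : ℝ → ℝⁿ a differentiable trajectory such that for all t ≥ t₀, fderiv ℝ h (x t) (deriv x t) ≥ −α(h (x t)). If h (x t₀) ≥ 0, then x t ∈ S for all t ≥ t₀. -/
/-- Safety (forward invariance) along a closed-loop trajectory: if the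
zero-superlevel set of the `C¹` barrier function `h` is contained in the safe
set `S`, the trajectory `x` satisfies the CBF inequality
`(Dh)(x t) (x' t) ≥ -α (h (x t))` for all `t ≥ t₀` with `α` an extended
class-K function, and `h (x t₀) ≥ 0`, then `x t ∈ S` for all `t ≥ t₀`. -/
theorem cbf_forward_invariance_safety
    (n : ℕ) (hn : 0 < n)
    (α : ℝ → ℝ) (hα_cont : Continuous α) (hα_mono : StrictMono α)
    (hα_zero : α 0 = 0)
    (h : EuclideanSpace ℝ (Fin n) → ℝ) (hh : ContDiff ℝ 1 h)
    (S : Set (EuclideanSpace ℝ (Fin n)))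
    (hS : {z : EuclideanSpace ℝ (Fin n) | h z ≥ 0} ⊆ S)
    (t₀ : ℝ) (x : ℝ → EuclideanSpace ℝ (Fin n)) (hx : Differentiable ℝ x)
    (hineq : ∀ t, t₀ ≤ t → fderiv ℝ h (x t) (deriv x t) ≥ -α (h (x t)))
    (h0 : h (x t₀) ≥ 0) :
    ∀ t, t₀ ≤ t → x t ∈ S := by
  intro t ht
  apply hS
  have hd : ∀ s, HasDerivAt (fun s => -h (x s)) (-(fderiv ℝ h (x s) (deriv x s))) s := by
    intro s
    have h1 : HasFDerivAt h (fderiv ℝ h (x s)) (x s) :=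
      ((hh.differentiable (by norm_num)) (x s)).hasFDerivAt
    exact (h1.comp_hasDerivAt s (hx s).hasDerivAt).neg
  have key : ∀ ε : ℝ, 0 < ε → -h (x t) ≤ 0 + ε := by
    intro ε hε
    have := image_le_of_deriv_right_lt_deriv_boundary (a := t₀) (b := t)
      (f := fun s => -h (x s)) (f' := fun s => -(fderiv ℝ h (x s) (deriv x s)))
      (B := fun _ => ε) (B' := fun _ => 0)
      (fun s _ => (hd s).continuousAt.continuousWithinAt)
      (fun s _ => (hd s).hasDerivWithinAt)
      (by linarith)
      (fun s => hasDerivAt_const s ε)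
      (by
        intro s hs hse
        have h1 := hineq s hs.1
        have h2 : α (h (x s)) < α 0 := hα_mono (by linarith)
        linarith)
      (Set.right_mem_Icc.mpr ht)
    linarith
  have := le_of_forall_pos_le_add key
  change h (x t) ≥ 0
  linarith
end

section
/- Let α : ℝ → ℝ be an extended class-K function (continuous, strictly increasing, α(0) = 0), t₀ ∈ ℝ, and h : ℝ → ℝ a Lipschitz continuous function such that for almost every t ≥ t₀ (with respect to Lebesgue measure), h is differentiable at t and deriv h t ≥ −α(h t). If h t₀ ≥ 0, then h t ≥ 0 for all t ≥ t₀. -/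
open MeasureTheory

/-- Locally Lipschitz relaxation of the comparison lemma: if `h` is Lipschitz
continuous and, for almost every `t ≥ t₀` (w.r.t. Lebesgue measure), `h` is
differentiable at `t` with `h' t ≥ -α (h t)` where `α` is an extended
class-K function, then `h t₀ ≥ 0` implies `h t ≥ 0` for all `t ≥ t₀`. -/
theorem cbf_comparison_lemma_lipschitz
    (α : ℝ → ℝ) (hα_cont : Continuous α) (hα_mono : StrictMono α)
    (hα_zero : α 0 = 0)
    (t₀ : ℝ) (h : ℝ → ℝ) (K : NNReal) (hlip : LipschitzWith K h)
    (hae : ∀ᵐ t ∂(volume : Measure ℝ), t₀ ≤ t →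
      DifferentiableAt ℝ h t ∧ deriv h t ≥ -α (h t))
    (h0 : h t₀ ≥ 0) :
    ∀ t, t₀ ≤ t → h t ≥ 0 := by
  intro t ht
  by_contra hneg
  have hneg' : h t < 0 := not_le.mp hneg
  have hcomp : IsCompact (Set.Icc t₀ t ∩ {s | 0 ≤ h s}) :=
    isCompact_Icc.inter_right (isClosed_le continuous_const hlip.continuous)
  obtain ⟨s, ⟨⟨hs0, hst⟩, hs⟩, hmax⟩ :=
    hcomp.exists_isGreatest ⟨t₀, ⟨le_refl _, ht⟩, h0⟩
  have hs : 0 ≤ h s := hs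
  have hac : AbsolutelyContinuousOnInterval h s t :=
    (hlip.lipschitzOnWith (s := Set.uIcc s t)).absolutelyContinuousOnInterval
  have hint := hac.integral_deriv_eq_sub
  have hnn : 0 ≤ ∫ x in s..t, deriv h x := by
    rw [intervalIntegral.integral_of_le hst]
    apply setIntegral_nonneg_of_ae_restrict
    rw [Filter.EventuallyLE, ae_restrict_iff' measurableSet_Ioc]
    filter_upwards [hae] with x hx hxm
    have h1 := (hx (hs0.trans hxm.1.le)).2
    have h2 : h x < 0 := by
      by_contra hc
      exact absurd (hmax ⟨⟨hs0.trans hxm.1.le, hxm.2⟩, not_lt.mp hc⟩) (not_le.mpr hxm.1)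
    have h3 := hα_mono h2
    rw [hα_zero] at h3
    change 0 ≤ deriv h x
    linarith
  linarith
end

section
/- Let n be a positive integer, Q an n×n real symmetric positive definite matrix, K ⊆ ℝⁿ a compact set, t₀ ∈ ℝ, V : ℝⁿ → ℝ a continuous positive definite function (V 0 = 0 and V z > 0 for all z ≠ 0), and e : ℝ → ℝⁿ a function with e t ∈ K for all t ≥ t₀, such that t ↦ V (e t) is differentiable on [t₀, ∞) and deriv (fun t => V (e t)) t ≤ −((e t) ⬝ (Q.mulVec (e t))) for all t ≥ t₀. Then e t → 0 as t → ∞ (Tendsto e atTop (nhds 0)). -/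
open Matrix Filter

/-- Goal-reaching (Theorem 1, part (ii)): if a continuous positive definite
function `V` decreases along the trajectory `e`, which stays in a compact set,
at rate `d/dt V(e t) ≤ -e(t) ⬝ Q e(t)` with `Q` symmetric positive definite,
then `e t → 0` as `t → ∞`. -/
theorem lyapunov_goal_reaching
    (n : ℕ) (hn : 0 < n)
    (Q : Matrix (Fin n) (Fin n) ℝ) (hQsymm : Qᵀ = Q) (hQ : Q.PosDef)
    (K : Set (EuclideanSpace ℝ (Fin n))) (hK : IsCompact K)
    (t₀ : ℝ)
    (V : EuclideanSpace ℝ (Fin n) → ℝ) (hVcont : Continuous V)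
    (hV0 : V 0 = 0) (hVpos : ∀ z : EuclideanSpace ℝ (Fin n), z ≠ 0 → 0 < V z)
    (e : ℝ → EuclideanSpace ℝ (Fin n)) (heK : ∀ t, t₀ ≤ t → e t ∈ K)
    (hdiff : ∀ t, t₀ ≤ t → DifferentiableAt ℝ (fun s => V (e s)) t)
    (hderiv : ∀ t, t₀ ≤ t →
      deriv (fun s => V (e s)) t ≤ -((e t) ⬝ᵥ Q.mulVec (e t))) :
    Tendsto e atTop (nhds 0) := by
  have hqc : Continuous (fun z : EuclideanSpace ℝ (Fin n) => (z ⬝ᵥ Q.mulVec z : ℝ)) := by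
    simp only [dotProduct, Matrix.mulVec]
    fun_prop
  have hqpos : ∀ z : EuclideanSpace ℝ (Fin n), z ≠ 0 → (0 : ℝ) < z ⬝ᵥ Q.mulVec z := by
    intro z hz
    have hz' : (z : Fin n → ℝ) ≠ 0 := by
      intro h
      apply hz
      ext i
      exact congrFun h i
    simpa using hQ.dotProduct_mulVec_pos hz'
  have hqnn : ∀ z : EuclideanSpace ℝ (Fin n), (0 : ℝ) ≤ z ⬝ᵥ Q.mulVec z := by
    intro z
    by_cases hz : z = 0
    · subst hz
      simp
    · exact (hqpos z hz).le
  -- mean value inequality along the trajectory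
  have hmv : ∀ m : ℝ, (∀ t, t₀ ≤ t → m ≤ (e t) ⬝ᵥ Q.mulVec (e t)) →
      ∀ s t, t₀ ≤ s → s ≤ t → V (e t) - V (e s) ≤ (-m) * (t - s) := by
    intro m hm s t hs hst
    refine (convex_Ici t₀).image_sub_le_mul_sub_of_deriv_le (f := fun s => V (e s))
      (fun x hx => (hdiff x hx).continuousAt.continuousWithinAt)
      (fun x hx => (hdiff x (interior_subset hx)).differentiableWithinAt)
      (fun x hx => ?_) s hs t (le_trans hs hst) hst
    have h1 := hderiv x (interior_subset hx)
    have h2 := hm x (interior_subset hx)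
    linarith
  -- the value gets below every positive level
  have hsmall : ∀ c : ℝ, 0 < c → ∃ t, t₀ ≤ t ∧ V (e t) < c := by
    intro c hc
    by_contra! hcon
    obtain ⟨m, hm, hmle⟩ := (hK.inter_right (isClosed_le continuous_const hVcont :
      IsClosed {z | c ≤ V z})).exists_forall_le' hqc.continuousOn (a := 0) (by
        rintro z ⟨-, hz⟩
        apply hqpos
        rintro rfl
        have hz' : c ≤ V 0 := hz
        linarith)
    have hd := hmv m (fun t ht => hmle _ ⟨heK t ht, hcon t ht⟩) t₀ (t₀ + V (e t₀) / m) le_rfl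
    have h0 : c ≤ V (e t₀) := hcon t₀ le_rfl
    have hp : 0 ≤ V (e t₀) / m := div_nonneg (hc.le.trans h0) hm.le
    have h1 := hd (by linarith)
    have h2 := hcon (t₀ + V (e t₀) / m) (by linarith)
    have h3 : (-m) * (t₀ + V (e t₀) / m - t₀) = - V (e t₀) := by
      field_simp
      ring
    linarith
  rw [tendsto_nhds]
  intro U hU h0U
  obtain ⟨c, hc, hcle⟩ := (hK.diff hU).exists_forall_le' hVcont.continuousOn (a := 0) (by
    rintro z ⟨-, hz⟩
    apply hVpos
    rintro rfl
    exact hz h0U)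
  obtain ⟨T, hT, hTc⟩ := hsmall c hc
  filter_upwards [eventually_ge_atTop T] with t ht
  by_contra hn
  have h1 := hcle (e t) ⟨heK t (hT.trans ht), hn⟩
  have h2 := hmv 0 (fun t _ => hqnn _) T t hT ht
  linarith
end

section
/- Let n be a positive integer, Q an n×n real symmetric positive definite matrix, t₀ ∈ ℝ, V : ℝⁿ → ℝ a continuous positive definite function (V 0 = 0 and V z > 0 for all z ≠ 0), K ⊆ ℝⁿ a compact set, and e : ℝ → ℝⁿ with e t ∈ K for all t ≥ t₀, such that t ↦ V (e t) is differentiable on [t₀, ∞) and deriv (fun t => V (e t)) t ≤ −((e t) ⬝ (Q.mulVec (e t))) for all t ≥ t₀. Then the function t ↦ V (e t) is nonincreasing on [t₀, ∞) and V (e t) → 0 as t → ∞. -/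
open Matrix Filter

/-- Intermediate Lyapunov claim: if the continuous positive definite function
`V` satisfies `d/dt V(e t) ≤ -e(t) ⬝ Q e(t)` along a trajectory `e` staying in
a compact set, then `t ↦ V (e t)` is nonincreasing on `[t₀, ∞)` and tends to
`0` as `t → ∞`. -/
theorem lyapunov_value_nonincreasing_tendsto_zero
    (n : ℕ) (hn : 0 < n)
    (Q : Matrix (Fin n) (Fin n) ℝ) (hQsymm : Qᵀ = Q) (hQ : Q.PosDef)
    (t₀ : ℝ)
    (V : EuclideanSpace ℝ (Fin n) → ℝ) (hVcont : Continuous V)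
    (hV0 : V 0 = 0) (hVpos : ∀ z : EuclideanSpace ℝ (Fin n), z ≠ 0 → 0 < V z)
    (K : Set (EuclideanSpace ℝ (Fin n))) (hK : IsCompact K)
    (e : ℝ → EuclideanSpace ℝ (Fin n)) (heK : ∀ t, t₀ ≤ t → e t ∈ K)
    (hdiff : ∀ t, t₀ ≤ t → DifferentiableAt ℝ (fun s => V (e s)) t)
    (hderiv : ∀ t, t₀ ≤ t →
      deriv (fun s => V (e s)) t ≤ -((e t) ⬝ᵥ Q.mulVec (e t))) :
    AntitoneOn (fun t => V (e t)) (Set.Ici t₀) ∧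
    Tendsto (fun t => V (e t)) atTop (nhds 0) := by
  have hqcont : Continuous (fun z : EuclideanSpace ℝ (Fin n) => z.ofLp ⬝ᵥ Q.mulVec z.ofLp) := by
    have h1 : Continuous (fun z : EuclideanSpace ℝ (Fin n) => z.ofLp) :=
      PiLp.continuous_ofLp 2 _
    exact h1.dotProduct (continuous_const.matrix_mulVec h1)
  have hqpos : ∀ z : EuclideanSpace ℝ (Fin n), z ≠ 0 → 0 < z.ofLp ⬝ᵥ Q.mulVec z.ofLp := by
    intro z hz
    have hz' : z.ofLp ≠ 0 := by
      intro h
      apply hz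
      ext i
      simp [h]
    simpa using hQ.dotProduct_mulVec_pos hz'
  have hqnn : ∀ z : EuclideanSpace ℝ (Fin n), 0 ≤ z.ofLp ⬝ᵥ Q.mulVec z.ofLp := by
    intro z
    by_cases hz : z = 0
    · simp [hz]
    · exact (hqpos z hz).le
  have hVnn : ∀ z, 0 ≤ V z := by
    intro z
    by_cases hz : z = 0
    · simp [hz, hV0]
    · exact (hVpos z hz).le
  have hcont : ContinuousOn (fun s => V (e s)) (Set.Ici t₀) :=
    fun t ht => (hdiff t ht).continuousAt.continuousWithinAt
  have hdo : DifferentiableOn ℝ (fun s => V (e s)) (interior (Set.Ici t₀)) :=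
    fun t ht => (hdiff t (interior_subset ht)).differentiableWithinAt
  have hanti : AntitoneOn (fun t => V (e t)) (Set.Ici t₀) := by
    apply antitoneOn_of_deriv_nonpos (convex_Ici t₀) hcont hdo
    intro t ht
    have h1 := hderiv t (interior_subset ht)
    have h2 := hqnn (e t)
    linarith
  refine ⟨hanti, ?_⟩
  have key : ∀ ε > 0, ∃ T, t₀ ≤ T ∧ V (e T) < ε := by
    intro ε hε
    by_contra! hcon
    have hC : IsCompact (K ∩ {z | ε ≤ V z}) :=
      hK.inter_right (isClosed_le continuous_const hVcont)
    obtain ⟨z, hz, hmin⟩ := hC.exists_isMinOn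
      ⟨e t₀, heK t₀ le_rfl, hcon t₀ le_rfl⟩ hqcont.continuousOn
    have hz0 : z ≠ 0 := by
      rintro rfl
      have : ε ≤ V 0 := hz.2
      linarith
    have hm := hqpos z hz0
    set m := z.ofLp ⬝ᵥ Q.mulVec z.ofLp with hmdef
    have hle : ∀ t, t₀ ≤ t → V (e t) - V (e t₀) ≤ -m * (t - t₀) := by
      intro t ht
      refine (convex_Ici t₀).image_sub_le_mul_sub_of_deriv_le hcont hdo ?_ t₀
        Set.self_mem_Ici t ht ht
      intro s hs
      have hs' : t₀ ≤ s := interior_subset hs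
      have h1 := hderiv s hs'
      have h2 : m ≤ (e s).ofLp ⬝ᵥ Q.mulVec (e s).ofLp := hmin ⟨heK s hs', hcon s hs'⟩
      linarith
    have hd : 0 ≤ V (e t₀) / m := div_nonneg (hVnn _) hm.le
    have h1 := hle (t₀ + V (e t₀) / m) (by linarith)
    have h2 := hcon (t₀ + V (e t₀) / m) (by linarith)
    have h3 : m * (V (e t₀) / m) = V (e t₀) := by field_simp
    have h4 : -m * (t₀ + V (e t₀) / m - t₀) = - (m * (V (e t₀) / m)) := by ring
    rw [h4, h3] at h1
    linarith
  rw [Metric.tendsto_atTop]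
  intro ε hε
  obtain ⟨T, hT, hVT⟩ := key ε hε
  refine ⟨T, fun t ht => ?_⟩
  have h : V (e t) ≤ V (e T) := hanti (Set.mem_Ici.2 hT) (Set.mem_Ici.2 (hT.trans ht)) ht
  rw [Real.dist_eq, sub_zero, abs_of_nonneg (hVnn _)]
  linarith
end
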